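/- Let A be an n×n binary array with a maximal sequence of vertical boundaries b₁ < … < b_k (k ≥ 1) with shadows and types t₁, …, t_k, and let its transpose Aᵀ have a maximal sequence of vertical boundaries (the horizontal boundaries of A) c₁ < … < c_l (l ≥ 1) with shadows and types s₁, …, s_l, both with respect to the same real threshold c > 0. Let T_v = t₁ + … + t_k, T_h = s₁ + … + s_l and T = min(T_v, T_h). Then A can be tiled into at most T + 1 tiles each of weight at most c. -/

import Mathlib

/-- `A` is a binary array: every entry is `0` or `1`. -/
def Binary (A : ℕ → ℕ → ℕ) : Prop := ∀ r c, A r c ≤ 1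

/-- `colW n A i j` is the total weight of columns `i` through `j` of the `n×n` array `A`
(rows and columns indexed `1,…,n`); it is `0` when the column range is empty. -/
def colW (n : ℕ) (A : ℕ → ℕ → ℕ) (i j : ℕ) : ℕ :=
  ∑ r ∈ Finset.Icc 1 n, ∑ col ∈ Finset.Icc i j, A r col

/-- The subarray of `A` consisting of columns `i..j` can be partitioned horizontally into
`m` tiles of weight at most `c`: the rows `{1,…,n}` are split into `m` contiguous
(possibly empty) intervals by cut points `f 0 = 0 ≤ f 1 ≤ … ≤ f m = n` (the `t`-th
interval being rows `{f t + 1, …, f (t+1)}`), and the weight of each tile is `≤ c`. -/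
def HorizPartition (n : ℕ) (A : ℕ → ℕ → ℕ) (i j m : ℕ) (c : ℝ) : Prop :=
  ∃ f : ℕ → ℕ, Monotone f ∧ f 0 = 0 ∧ f m = n ∧
    ∀ t < m,
      (∑ r ∈ Finset.Ioc (f t) (f (t + 1)), ∑ col ∈ Finset.Icc i j, (A r col : ℝ)) ≤ c

/-- A maximal sequence of `k` vertical boundaries of the `n×n` array `A` with respect to
the threshold `c`, as in Definition 1 of the paper: boundary columns
`1 ≤ b 1 < b 2 < … < b k ≤ n`, shadows `sh i ∈ {b i, b i + 1}`, and types
`t i = ⌊w(A[b i..b i])/c⌋ + 1`, satisfying the iterative defining conditions (1)–(5)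
together with the maximality condition (6) at the last boundary. -/
structure VBoundaries (n : ℕ) (A : ℕ → ℕ → ℕ) (c : ℝ) (k : ℕ) where
  /-- the boundary columns `b 1, …, b k` -/
  b : ℕ → ℕ
  /-- the shadow columns `sh 1, …, sh k` -/
  sh : ℕ → ℕ
  /-- the types `t 1, …, t k` -/
  t : ℕ → ℕ
  one_le_b : 1 ≤ b 1
  b_le_n : b k ≤ n
  strict : ∀ i, 1 ≤ i → i < k → b i < b (i + 1)
  shadow_mem : ∀ i, 1 ≤ i → i ≤ k → sh i = b i ∨ sh i = b i + 1
  type_def : ∀ i, 1 ≤ i → i ≤ k → t i = ⌊(colW n A (b i) (b i) : ℝ) / c⌋₊ + 1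
  /-- (1): the first boundary is where the prefix weight first exceeds `c`. -/
  first_le : (colW n A 1 (b 1 - 1) : ℝ) ≤ c
  first_gt : (colW n A 1 (b 1) : ℝ) > c
  /-- (2): the first shadow. -/
  shadow_one : sh 1 = b 1 ↔ ¬ HorizPartition n A 1 (b 1) (t 1) c
  /-- (3): the next boundary, case `sh i = b i`. -/
  step_eq : ∀ i, 1 ≤ i → i < k → sh i = b i →
    HorizPartition n A (b i) (b (i + 1) - 1) (t i) c ∧
      ¬ HorizPartition n A (b i) (b (i + 1)) (t i) c
  /-- (4): the next boundary, case `sh i ≠ b i`. -/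
  step_ne : ∀ i, 1 ≤ i → i < k → sh i ≠ b i →
    (colW n A (b i + 1) (b (i + 1) - 1) : ℝ) ≤ c ∧
      (colW n A (b i + 1) (b (i + 1)) : ℝ) > c
  /-- (5): the next shadow. -/
  shadow_succ : ∀ i, 1 ≤ i → i < k →
    (sh (i + 1) = b (i + 1) ↔ ¬ HorizPartition n A (sh i) (b (i + 1)) (t (i + 1)) c)
  /-- (6): maximality, case `sh k = b k`. -/
  max_eq : sh k = b k → HorizPartition n A (b k) n (t k) c
  /-- (6): maximality, case `sh k ≠ b k`. -/
  max_ne : sh k ≠ b k → (colW n A (b k + 1) n : ℝ) ≤ c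

/-- `R` is an axis-aligned rectangle: the product of a contiguous row interval and a
contiguous column interval (possibly empty). -/
def IsRect (R : Finset (ℕ × ℕ)) : Prop :=
  ∃ r₁ r₂ c₁ c₂ : ℕ, R = Finset.Icc r₁ r₂ ×ˢ Finset.Icc c₁ c₂

/-- The set of cells `S` can be tiled with at most `N` pairwise disjoint axis-aligned
rectangles whose union is `S` and each of whose weights (sum of entries of `A`) is at
most `c`. -/
def TiledBy (A : ℕ → ℕ → ℕ) (S : Finset (ℕ × ℕ)) (N : ℕ) (c : ℝ) : Prop :=
  ∃ T : Finset (Finset (ℕ × ℕ)), T.card ≤ N ∧ (∀ R ∈ T, IsRect R) ∧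
    (T : Set (Finset (ℕ × ℕ))).PairwiseDisjoint id ∧ T.sup id = S ∧
    ∀ R ∈ T, (∑ p ∈ R, (A p.1 p.2 : ℝ)) ≤ c

/-- The full grid of cells `{1,…,n} × {1,…,n}`. -/
def grid (n : ℕ) : Finset (ℕ × ℕ) := Finset.Icc 1 n ×ˢ Finset.Icc 1 n

theorem TiledBy.mono' {A : ℕ → ℕ → ℕ} {S : Finset (ℕ × ℕ)} {N M : ℕ} {c : ℝ}
    (h : TiledBy A S N c) (hNM : N ≤ M) : TiledBy A S M c := by
  obtain ⟨T, h1, h2⟩ := h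
  exact ⟨T, h1.trans hNM, h2⟩

theorem TiledBy.union' {A : ℕ → ℕ → ℕ} {S₁ S₂ : Finset (ℕ × ℕ)} {N M : ℕ} {c : ℝ}
    (h₁ : TiledBy A S₁ N c) (h₂ : TiledBy A S₂ M c) (hd : Disjoint S₁ S₂) :
    TiledBy A (S₁ ∪ S₂) (N + M) c := by
  obtain ⟨T₁, a1, a2, a3, a4, a5⟩ := h₁
  obtain ⟨T₂, b1, b2, b3, b4, b5⟩ := h₂
  have sub1 : ∀ R ∈ T₁, R ≤ S₁ := fun R hR => a4 ▸ Finset.le_sup (f := id) hR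
  have sub2 : ∀ R ∈ T₂, R ≤ S₂ := fun R hR => b4 ▸ Finset.le_sup (f := id) hR
  refine ⟨T₁ ∪ T₂, (Finset.card_union_le _ _).trans (Nat.add_le_add a1 b1), ?_, ?_, ?_, ?_⟩
  · intro R hR
    rcases Finset.mem_union.1 hR with h | h
    exacts [a2 R h, b2 R h]
  · intro R hR R' hR' hne
    rcases Finset.mem_union.1 (Finset.mem_coe.1 hR) with h | h <;>
      rcases Finset.mem_union.1 (Finset.mem_coe.1 hR') with h' | h'
    · exact a3 h h' hne
    · exact hd.mono (sub1 R h) (sub2 R' h')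
    · exact (hd.mono (sub1 R' h') (sub2 R h)).symm
    · exact b3 h h' hne
  · rw [Finset.sup_union, a4, b4]; rfl
  · intro R hR
    rcases Finset.mem_union.1 hR with h | h
    exacts [a5 R h, b5 R h]

theorem tiledBy_one {A : ℕ → ℕ → ℕ} {R : Finset (ℕ × ℕ)} {c : ℝ} (hR : IsRect R)
    (h : (∑ p ∈ R, (A p.1 p.2 : ℝ)) ≤ c) : TiledBy A R 1 c :=
  ⟨{R}, by simp, by simpa using hR, by simp, by simp, by simpa using h⟩

theorem tiledBy_empty (A : ℕ → ℕ → ℕ) (c : ℝ) : TiledBy A ∅ 0 c :=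
  ⟨∅, by simp, by simp, by simp, by simp, by simp⟩

/-- Full-height strip of columns `i..j`. -/
def strip (n i j : ℕ) : Finset (ℕ × ℕ) := Finset.Icc 1 n ×ˢ Finset.Icc i j

theorem strip_tiled_one {n : ℕ} {A : ℕ → ℕ → ℕ} {i j : ℕ} {c : ℝ}
    (h : (colW n A i j : ℝ) ≤ c) : TiledBy A (strip n i j) 1 c := by
  apply tiledBy_one ⟨1, n, i, j, rfl⟩
  rw [Finset.sum_product]
  simpa [colW] using h

theorem strip_tiled {n : ℕ} {A : ℕ → ℕ → ℕ} {i j m : ℕ} {c : ℝ}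
    (h : HorizPartition n A i j m c) : TiledBy A (strip n i j) m c := by
  obtain ⟨f, hf, h0, hm, hw⟩ := h
  have key : ∀ s, s ≤ m → TiledBy A (Finset.Ioc 0 (f s) ×ˢ Finset.Icc i j) s c := by
    intro s
    induction s with
    | zero => intro _; simpa [h0] using tiledBy_empty A c
    | succ s ih =>
      intro hs
      have hle : f s ≤ f (s + 1) := hf (Nat.le_succ s)
      have h2 : TiledBy A (Finset.Ioc (f s) (f (s + 1)) ×ˢ Finset.Icc i j) 1 c := by
        apply tiledBy_one
        · refine ⟨f s + 1, f (s + 1), i, j, ?_⟩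
          ext ⟨x, y⟩
          simp only [Finset.mem_product, Finset.mem_Ioc, Finset.mem_Icc]
          omega
        · rw [Finset.sum_product]; exact hw s (by omega)
      have h3 := (ih (by omega)).union' h2 (by
        rw [Finset.disjoint_left]
        rintro ⟨x, y⟩
        simp only [Finset.mem_product, Finset.mem_Ioc]
        omega)
      convert h3 using 1
      ext ⟨x, y⟩
      simp only [Finset.mem_product, Finset.mem_Ioc, Finset.mem_Icc, Finset.mem_union]
      omega
  have := key m le_rfl
  rw [hm] at this
  convert this using 1
  ext ⟨x, y⟩
  simp only [strip, Finset.mem_product, Finset.mem_Ioc, Finset.mem_Icc]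
  omega

theorem strip_union {n : ℕ} {A : ℕ → ℕ → ℕ} {a b N M : ℕ} {c : ℝ} (hab : a ≤ b)
    (h₁ : TiledBy A (strip n 1 a) N c) (h₂ : TiledBy A (strip n (a + 1) b) M c) :
    TiledBy A (strip n 1 b) (N + M) c := by
  have h3 := h₁.union' h₂ (by
    rw [Finset.disjoint_left]
    rintro ⟨x, y⟩
    simp only [strip, Finset.mem_product, Finset.mem_Icc]
    omega)
  convert h3 using 1
  ext ⟨x, y⟩
  simp only [strip, Finset.mem_product, Finset.mem_Icc, Finset.mem_union]
  omega

theorem tiled_vertical {n : ℕ} {A : ℕ → ℕ → ℕ} {c : ℝ} {k : ℕ} (hk : 1 ≤ k)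
    (B : VBoundaries n A c k) :
    TiledBy A (grid n) (∑ i ∈ Finset.Icc 1 k, B.t i + 1) c := by
  have key : ∀ i, i + 1 ≤ k → 1 ≤ B.b (i + 1) ∧
      (B.sh (i + 1) = B.b (i + 1) →
        TiledBy A (strip n 1 (B.b (i + 1) - 1)) (∑ j ∈ Finset.Icc 1 i, B.t j + 1) c) ∧
      (B.sh (i + 1) ≠ B.b (i + 1) →
        TiledBy A (strip n 1 (B.b (i + 1))) (∑ j ∈ Finset.Icc 1 (i + 1), B.t j) c) := by
    intro i
    induction i with
    | zero =>
      intro _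
      refine ⟨B.one_le_b, fun _ => ?_, fun h => ?_⟩
      · simpa using strip_tiled_one B.first_le
      · have := not_not.1 (fun h' => h (B.shadow_one.2 h'))
        simpa using strip_tiled this
    | succ i ih =>
      intro hi
      obtain ⟨h1, h2, h3⟩ := ih (by omega)
      have hlt := B.strict (i + 1) (by omega) (by omega)
      have ht : 1 ≤ B.t (i + 1) := by
        rw [B.type_def (i + 1) (by omega) (by omega)]; omega
      have e1 : ∑ j ∈ Finset.Icc 1 (i + 1), B.t j
          = ∑ j ∈ Finset.Icc 1 i, B.t j + B.t (i + 1) :=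
        Finset.sum_Icc_succ_top (by omega) _
      have e2 : ∑ j ∈ Finset.Icc 1 (i + 1 + 1), B.t j
          = ∑ j ∈ Finset.Icc 1 (i + 1), B.t j + B.t (i + 1 + 1) :=
        Finset.sum_Icc_succ_top (by omega) _
      refine ⟨by omega, fun h => ?_, fun h => ?_⟩
      · by_cases hs : B.sh (i + 1) = B.b (i + 1)
        · have hp := strip_tiled (B.step_eq (i + 1) (by omega) (by omega) hs).1
          rw [← Nat.sub_add_cancel h1] at hp
          have := strip_union (by omega) (h2 hs) hp
          exact this.mono' (by omega)
        · have hp := strip_tiled_one (B.step_ne (i + 1) (by omega) (by omega) hs).1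
          exact strip_union (by omega) (h3 hs) hp
      · have hp := strip_tiled (not_not.1 (fun h' =>
          h ((B.shadow_succ (i + 1) (by omega) (by omega)).2 h')))
        by_cases hs : B.sh (i + 1) = B.b (i + 1)
        · rw [hs] at hp
          rw [← Nat.sub_add_cancel h1] at hp
          have := strip_union (by omega) (h2 hs) hp
          exact this.mono' (by omega)
        · rw [(B.shadow_mem (i + 1) (by omega) (by omega)).resolve_left hs] at hp
          exact (strip_union (by omega) (h3 hs) hp).mono' (by omega)
  obtain ⟨i, rfl⟩ : ∃ i, k = i + 1 := ⟨k - 1, by omega⟩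
  obtain ⟨h1, h2, h3⟩ := key i le_rfl
  have hn := B.b_le_n
  have e1 : ∑ j ∈ Finset.Icc 1 (i + 1), B.t j
      = ∑ j ∈ Finset.Icc 1 i, B.t j + B.t (i + 1) :=
    Finset.sum_Icc_succ_top (by omega) _
  change TiledBy A (strip n 1 n) _ c
  by_cases hs : B.sh (i + 1) = B.b (i + 1)
  · have hp := strip_tiled (B.max_eq hs)
    rw [← Nat.sub_add_cancel h1] at hp
    have := strip_union (by omega) (h2 hs) hp
    exact this.mono' (by omega)
  · exact strip_union hn (h3 hs) (strip_tiled_one (B.max_ne hs))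

theorem TiledBy.transpose' {A : ℕ → ℕ → ℕ} {S : Finset (ℕ × ℕ)} {N : ℕ} {c : ℝ}
    (h : TiledBy (fun r col => A col r) S N c) :
    TiledBy A (S.map (Equiv.prodComm ℕ ℕ).toEmbedding) N c := by
  obtain ⟨T, h1, h2, h3, h4, h5⟩ := h
  refine ⟨T.map (Finset.mapEmbedding (Equiv.prodComm ℕ ℕ).toEmbedding).toEmbedding,
    by simpa using h1, ?_, ?_, ?_, ?_⟩
  · intro R hR
    obtain ⟨Q, hQ, rfl⟩ := Finset.mem_map.1 hR
    obtain ⟨a, b, x, y, rfl⟩ := h2 Q hQ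
    refine ⟨x, y, a, b, ?_⟩
    ext ⟨p, q⟩
    simp [and_comm]
  · intro R hR R' hR' hne
    obtain ⟨Q, hQ, rfl⟩ := Finset.mem_map.1 (Finset.mem_coe.1 hR)
    obtain ⟨Q', hQ', rfl⟩ := Finset.mem_map.1 (Finset.mem_coe.1 hR')
    have := h3 hQ hQ' (fun e => hne (by rw [e]))
    exact (Finset.disjoint_map _).2 this
  · rw [← h4]
    ext ⟨p, q⟩
    simp [Finset.mem_sup]
  · intro R hR
    obtain ⟨Q, hQ, rfl⟩ := Finset.mem_map.1 hR
    simpa using h5 Q hQ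

/-- **Fact F1.** If the `n×n` binary array `A` has a maximal sequence of
`k ≥ 1` vertical boundaries with type sum `T_v`, and its transpose has a maximal
sequence of `l ≥ 1` vertical boundaries (the horizontal boundaries of `A`) with type
sum `T_h`, both w.r.t. the threshold `c > 0`, and `T = min(T_v, T_h)`, then `A` can be
tiled into at most `T + 1` axis-aligned rectangular tiles each of weight at most `c`. -/
theorem stmt6 (n : ℕ) (A : ℕ → ℕ → ℕ) (hA : Binary A) (c : ℝ) (hc : 0 < c)
    (k l : ℕ) (hk : 1 ≤ k) (hl : 1 ≤ l)
    (B : VBoundaries n A c k) (C : VBoundaries n (fun r col => A col r) c l) :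
    TiledBy A (grid n)
      (min (∑ i ∈ Finset.Icc 1 k, B.t i) (∑ i ∈ Finset.Icc 1 l, C.t i) + 1) c := by
  have h1 := tiled_vertical hk B
  have h2 := (tiled_vertical hl C).transpose'
  have e : (grid n).map (Equiv.prodComm ℕ ℕ).toEmbedding = grid n := by
    ext ⟨p, q⟩
    simp [grid, and_comm]
  rw [e] at h2
  rcases le_total (∑ i ∈ Finset.Icc 1 k, B.t i) (∑ i ∈ Finset.Icc 1 l, C.t i) with h | h
  · rwa [min_eq_left h]
  · rwa [min_eq_right h]
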